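/- Let A be a positive semidefinite operator on a finite-dimensional complex Hilbert space and let S be a compact convex set of positive semidefinite operators on the same space. Then for any α ∈ (0,1), there exists an operator T with 0 ≤ T ≤ I such that for every B ∈ S, Tr[A(I−T)] + Tr[BT] ≤ sup_{B' ∈ S} Tr[A^α B'^{1−α}]. -/

import Mathlib

open scoped BigOperators ComplexOrder Classical
open MeasureTheory Filter Set

noncomputable section

namespace QHT

variable {ι : Type*} [Fintype ι] [DecidableEq ι]

/-- Generalized matrix power `A ^ w` (complex exponent `w`) of a Hermitian matrix,
via functional calculus on the support: the eigenvalue `0` is mapped to `0`. -/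
def mpow (A : Matrix ι ι ℂ) (w : ℂ) : Matrix ι ι ℂ :=
  if hA : A.IsHermitian then
    (hA.eigenvectorUnitary : Matrix ι ι ℂ) *
      Matrix.diagonal (fun i => if hA.eigenvalues i = 0 then 0 else (hA.eigenvalues i : ℂ) ^ w) *
      star (hA.eigenvectorUnitary : Matrix ι ι ℂ)
  else 0

/-- Matrix logarithm of a Hermitian matrix, taken on its support
(`Real.log 0 = 0`, so the kernel is mapped to `0`). -/
def mlog (A : Matrix ι ι ℂ) : Matrix ι ι ℂ :=
  if hA : A.IsHermitian then
    (hA.eigenvectorUnitary : Matrix ι ι ℂ) *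
      Matrix.diagonal (fun i => (Real.log (hA.eigenvalues i) : ℂ)) *
      star (hA.eigenvectorUnitary : Matrix ι ι ℂ)
  else 0

/-- The support of a matrix, i.e. its range as a linear map. -/
def msupp (A : Matrix ι ι ℂ) : Submodule ℂ (ι → ℂ) := LinearMap.range A.mulVecLin

/-- A quantum state: a positive semidefinite matrix of trace one. -/
def IsState (A : Matrix ι ι ℂ) : Prop := A.PosSemidef ∧ A.trace = 1

/-- Real part of the trace. -/
def rtr (A : Matrix ι ι ℂ) : ℝ := A.trace.re

/-- The Umegaki relative entropy `D(ρ‖σ)`, with value `+∞` when `supp ρ ⊄ supp σ`. -/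
def relEnt (ρ σ : Matrix ι ι ℂ) : EReal :=
  if msupp ρ ≤ msupp σ then ((rtr (ρ * (mlog ρ - mlog σ)) : ℝ) : EReal) else ⊤

/-- The polar of a set of matrices (intersected with the PSD cone). -/
def polar (S : Set (Matrix ι ι ℂ)) : Set (Matrix ι ι ℂ) :=
  {X | X.PosSemidef ∧ ∀ Y ∈ S, rtr (X * Y) ≤ 1}

/-- Entrywise Bochner integral of a matrix-valued function over `ℝ`. -/
def mInt (f : ℝ → Matrix ι ι ℂ) : Matrix ι ι ℂ :=
  Matrix.of fun i j => ∫ t : ℝ, f t i j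

/-- Entrywise Bochner integral of a matrix-valued function over a set `s ⊆ ℝ`. -/
def mIntOn (f : ℝ → Matrix ι ι ℂ) (s : Set ℝ) : Matrix ι ι ℂ :=
  Matrix.of fun i j => ∫ t in s, f t i j

/-- `sinc` function. -/
def sinc (s : ℝ) : ℝ := if s = 0 then 1 else Real.sin s / s

/-- The probability density `β_θ` from the paper (`β₀` is the `θ → 0` limit). -/
def betaDist (θ t : ℝ) : ℝ :=
  if θ = 0 then Real.pi / (2 * (Real.cosh (Real.pi * t) + 1))
  else Real.sin (θ * Real.pi) / (2 * θ * (Real.cosh (Real.pi * t) + Real.cos (θ * Real.pi)))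

/-- `Q_{α,z}(ρ‖σ) = Tr[(ρ^{α/2z} σ^{(1-α)/z} ρ^{α/2z})^z]`. -/
def Qaz (α z : ℝ) (ρ σ : Matrix ι ι ℂ) : ℝ :=
  rtr (mpow (mpow ρ ((α / (2 * z) : ℝ) : ℂ) * mpow σ (((1 - α) / z : ℝ) : ℂ) *
      mpow ρ ((α / (2 * z) : ℝ) : ℂ)) ((z : ℝ) : ℂ))

/-- The `α`-`z` Rényi relative entropy. -/
def Daz (α z : ℝ) (ρ σ : Matrix ι ι ℂ) : EReal :=
  if (α < 1 ∧ (ρ * σ).trace ≠ 0) ∨ msupp ρ ≤ msupp σ then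
    (((α - 1)⁻¹ * Real.log (Qaz α z ρ σ) : ℝ) : EReal)
  else ⊤

/-- `Q_α(ρ‖σ) = Tr[ρ^α σ^{1-α}]` (Petz). -/
def Qpetz (α : ℝ) (ρ σ : Matrix ι ι ℂ) : ℝ :=
  rtr (mpow ρ ((α : ℝ) : ℂ) * mpow σ (((1 - α) : ℝ) : ℂ))

/-- The Petz Rényi divergence. -/
def Dpetz (α : ℝ) (ρ σ : Matrix ι ι ℂ) : EReal :=
  if (α < 1 ∧ (ρ * σ).trace ≠ 0) ∨ msupp ρ ≤ msupp σ then
    (((α - 1)⁻¹ * Real.log (Qpetz α ρ σ) : ℝ) : EReal)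
  else ⊤

/-- `Q̃_α(ρ‖σ) = Tr[(σ^{(1-α)/2α} ρ σ^{(1-α)/2α})^α]` (sandwiched). -/
def Qsand (α : ℝ) (ρ σ : Matrix ι ι ℂ) : ℝ :=
  rtr (mpow (mpow σ (((1 - α) / (2 * α) : ℝ) : ℂ) * ρ * mpow σ (((1 - α) / (2 * α) : ℝ) : ℂ))
    ((α : ℝ) : ℂ))

/-- The sandwiched Rényi divergence. -/
def Dsand (α : ℝ) (ρ σ : Matrix ι ι ℂ) : EReal :=
  if (α < 1 ∧ (ρ * σ).trace ≠ 0) ∨ msupp ρ ≤ msupp σ then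
    (((α - 1)⁻¹ * Real.log (Qsand α ρ σ) : ℝ) : EReal)
  else ⊤

/-- `D̃_∞(ρ‖σ)`: the limit of `D̃_α(ρ‖σ)` as `α → +∞` (encoded as a `limsup`; the limit
exists by monotonicity in `α`). -/
def DsandInf (ρ σ : Matrix ι ι ℂ) : EReal :=
  Filter.limsup (fun α : ℝ => Dsand α ρ σ) Filter.atTop

/-- `χ_{α,z}(ρ,σ) = ρ^{α/2z} (ρ^{α/2z} σ^{(1-α)/z} ρ^{α/2z})^{z-1} ρ^{α/2z}`. -/
def chi (α z : ℝ) (ρ σ : Matrix ι ι ℂ) : Matrix ι ι ℂ :=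
  mpow ρ ((α / (2 * z) : ℝ) : ℂ) *
    mpow (mpow ρ ((α / (2 * z) : ℝ) : ℂ) * mpow σ (((1 - α) / z : ℝ) : ℂ) *
      mpow ρ ((α / (2 * z) : ℝ) : ℂ)) (((z - 1 : ℝ)) : ℂ) *
    mpow ρ ((α / (2 * z) : ℝ) : ℂ)

/-- The data-processing region `𝒟` for `α`-`z` Rényi relative entropies. -/
def Dregion : Set (ℝ × ℝ) :=
  {p | (0 < p.1 ∧ p.1 < 1 ∧ max p.1 (1 - p.1) ≤ p.2) ∨
       (1 < p.1 ∧ max (p.1 / 2) (p.1 - 1) ≤ p.2 ∧ p.2 ≤ p.1) ∨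
       (p.1 = 1 ∧ 0 < p.2)}

end QHT

namespace QHT

variable {ι : Type*} [Fintype ι] [DecidableEq ι]

/-! ### Tensor products and many copies -/

/-- Tensor product of a `d₁`- and a `d₂`-dimensional operator, as a `d₁d₂`-dimensional one. -/
def dtens {a b : ℕ} (A : Matrix (Fin a) (Fin a) ℂ) (B : Matrix (Fin b) (Fin b) ℂ) :
    Matrix (Fin (a * b)) (Fin (a * b)) ℂ :=
  Matrix.of fun x y =>
    A (finProdFinEquiv.symm x).1 (finProdFinEquiv.symm y).1 *
      B (finProdFinEquiv.symm x).2 (finProdFinEquiv.symm y).2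

/-- `ρ^{⊗n}` of a `d`-dimensional operator, as a `d^n`-dimensional operator. -/
def dpow {d : ℕ} (ρ : Matrix (Fin d) (Fin d) ℂ) (n : ℕ) :
    Matrix (Fin (d ^ n)) (Fin (d ^ n)) ℂ :=
  Matrix.of fun x y => ∏ i, ρ (finFunctionFinEquiv.symm x i) (finFunctionFinEquiv.symm y i)

/-- The action of a permutation of the `k` tensor factors on an operator on `(ℂ^d)^{⊗k}`. -/
def permMat (d k : ℕ) (π : Equiv.Perm (Fin k)) (A : Matrix (Fin (d ^ k)) (Fin (d ^ k)) ℂ) :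
    Matrix (Fin (d ^ k)) (Fin (d ^ k)) ℂ :=
  Matrix.of fun x y =>
    A (finFunctionFinEquiv ((finFunctionFinEquiv.symm x) ∘ π))
      (finFunctionFinEquiv ((finFunctionFinEquiv.symm y) ∘ π))

/-- `ρ^{⊗n}` of a `d`-dimensional operator, as an operator on `H^{⊗n}` with `H = ℂ^d`,
indexed by tuples. -/
def tpow {d : ℕ} (ρ : Matrix (Fin d) (Fin d) ℂ) (n : ℕ) :
    Matrix (Fin n → Fin d) (Fin n → Fin d) ℂ :=
  Matrix.of fun x y => ∏ i, ρ (x i) (y i)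

/-- Tensor product of an operator on `H^{⊗m}` and an operator on `H^{⊗n}`, as an
operator on `H^{⊗(m+n)}`. -/
def tensOp {d m n : ℕ} (A : Matrix (Fin m → Fin d) (Fin m → Fin d) ℂ)
    (B : Matrix (Fin n → Fin d) (Fin n → Fin d) ℂ) :
    Matrix (Fin (m + n) → Fin d) (Fin (m + n) → Fin d) ℂ :=
  Matrix.of fun x y =>
    A (fun i => x (Fin.castAdd n i)) (fun i => y (Fin.castAdd n i)) *
      B (fun j => x (Fin.natAdd m j)) (fun j => y (Fin.natAdd m j))

/-- Permutation action on operators on `H^{⊗k}`. -/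
def permOp {d k : ℕ} (π : Equiv.Perm (Fin k))
    (A : Matrix (Fin k → Fin d) (Fin k → Fin d) ℂ) :
    Matrix (Fin k → Fin d) (Fin k → Fin d) ℂ :=
  Matrix.of fun x y => A (x ∘ π) (y ∘ π)

/-! ### Hypothesis testing -/

/-- A test: an operator `T` with `0 ≤ T ≤ I`. -/
def IsTest (T : Matrix ι ι ℂ) : Prop := T.PosSemidef ∧ (1 - T).PosSemidef

/-- Type I error `α_n(ρ|T) = Tr[(I - T) ρ^{⊗n}]`. -/
def typeI {d : ℕ} (ρ : Matrix (Fin d) (Fin d) ℂ) (n : ℕ)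
    (T : Matrix (Fin n → Fin d) (Fin n → Fin d) ℂ) : ℝ :=
  rtr ((1 - T) * tpow ρ n)

/-- Type II error `β_n(S|T) = sup_{σ ∈ S} Tr[σ T]`. -/
def typeII {d n : ℕ} (S : Set (Matrix (Fin n → Fin d) (Fin n → Fin d) ℂ))
    (T : Matrix (Fin n → Fin d) (Fin n → Fin d) ℂ) : ℝ :=
  sSup ((fun σ => rtr (σ * T)) '' S)

/-- `- log x`, valued in `EReal`, with `- log x = +∞` for `x ≤ 0`. -/
def negLog (x : ℝ) : EReal := if x ≤ 0 then ⊤ else ((- Real.log x : ℝ) : EReal)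

/-- The exponential rate `-(1/n) log x`. -/
def rate (n : ℕ) (x : ℝ) : EReal := (((n : ℝ)⁻¹ : ℝ) : EReal) * negLog x

/-- The Stein exponent `s(ρ‖{S_n})`. -/
def steinExp {d : ℕ} (ρ : Matrix (Fin d) (Fin d) ℂ)
    (S : (n : ℕ) → Set (Matrix (Fin n → Fin d) (Fin n → Fin d) ℂ)) : EReal :=
  sSup ((fun r : ℝ => (r : EReal)) ''
    {r : ℝ | 0 ≤ r ∧ ∃ T : (n : ℕ) → Matrix (Fin n → Fin d) (Fin n → Fin d) ℂ,
      (∀ n, IsTest (T n)) ∧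
      (r : EReal) ≤ Filter.liminf (fun n => rate n (typeII (S n) (T n))) Filter.atTop ∧
      Filter.Tendsto (fun n => typeI ρ n (T n)) Filter.atTop (nhds 0)})

/-- The Chernoff exponent `c(ρ‖{S_n})`. -/
def chernoffExp {d : ℕ} (ρ : Matrix (Fin d) (Fin d) ℂ)
    (S : (n : ℕ) → Set (Matrix (Fin n → Fin d) (Fin n → Fin d) ℂ)) : EReal :=
  Filter.liminf (fun n =>
    rate n (sInf ((fun T => typeI ρ n T + typeII (S n) T) '' {T | IsTest T}))) Filter.atTop

/-- The Hoeffding (direct) exponent `d_r(ρ‖{S_n})`. -/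
def hoeffdingExp {d : ℕ} (r : ℝ) (ρ : Matrix (Fin d) (Fin d) ℂ)
    (S : (n : ℕ) → Set (Matrix (Fin n → Fin d) (Fin n → Fin d) ℂ)) : EReal :=
  ⨆ T : {T : (n : ℕ) → Matrix (Fin n → Fin d) (Fin n → Fin d) ℂ //
      (∀ n, IsTest (T n)) ∧
      (r : EReal) ≤ Filter.liminf (fun n => rate n (typeII (S n) (T n))) Filter.atTop},
    Filter.liminf (fun n => rate n (typeI ρ n (T.1 n))) Filter.atTop

/-- The strong converse exponent `sc_r(ρ‖{S_n})`. -/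
def scExp {d : ℕ} (r : ℝ) (ρ : Matrix (Fin d) (Fin d) ℂ)
    (S : (n : ℕ) → Set (Matrix (Fin n → Fin d) (Fin n → Fin d) ℂ)) : EReal :=
  ⨅ T : {T : (n : ℕ) → Matrix (Fin n → Fin d) (Fin n → Fin d) ℂ //
      (∀ n, IsTest (T n)) ∧
      (r : EReal) ≤ Filter.liminf (fun n => rate n (typeII (S n) (T n))) Filter.atTop},
    Filter.limsup (fun n => rate n (1 - typeI ρ n (T.1 n))) Filter.atTop

/-- Assumption 1 of the paper for a family `{S_n}_{n ≥ 1}` of sets of operators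
on `H^{⊗n}`, `H = ℂ^d`: each `S_n` is a convex compact set of positive semidefinite
operators, closed under tensor products, and with polar sets closed under tensor
products. -/
structure Assumption1 {d : ℕ}
    (S : (n : ℕ) → Set (Matrix (Fin n → Fin d) (Fin n → Fin d) ℂ)) : Prop where
  psd : ∀ n, 1 ≤ n → ∀ X ∈ S n, X.PosSemidef
  convex : ∀ n, 1 ≤ n → Convex ℝ (S n)
  compact : ∀ n, 1 ≤ n → IsCompact (S n)
  tens : ∀ m n, 1 ≤ m → 1 ≤ n → ∀ A ∈ S m, ∀ B ∈ S n, tensOp A B ∈ S (m + n)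
  polarTens : ∀ m n, 1 ≤ m → 1 ≤ n →
    ∀ A ∈ polar (S m), ∀ B ∈ polar (S n), tensOp A B ∈ polar (S (m + n))

/-- Assumption 1′ of the paper for a dimension-indexed family `{S_d}_{d ≥ 1}`. -/
structure Assumption1' (S : (d : ℕ) → Set (Matrix (Fin d) (Fin d) ℂ)) : Prop where
  psd : ∀ d, 1 ≤ d → ∀ X ∈ S d, X.PosSemidef
  convex : ∀ d, 1 ≤ d → Convex ℝ (S d)
  compact : ∀ d, 1 ≤ d → IsCompact (S d)
  tens : ∀ d₁ d₂, 1 ≤ d₁ → 1 ≤ d₂ → ∀ A ∈ S d₁, ∀ B ∈ S d₂, dtens A B ∈ S (d₁ * d₂)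
  polarTens : ∀ d₁ d₂, 1 ≤ d₁ → 1 ≤ d₂ →
    ∀ A ∈ polar (S d₁), ∀ B ∈ polar (S d₂), dtens A B ∈ polar (S (d₁ * d₂))

end QHT

namespace QHT

section Audenaert

open scoped Matrix.Norms.L2Operator MatrixOrder

variable {ι : Type*}

lemma isTest_iff_mem_Icc [DecidableEq ι] {T : Matrix ι ι ℂ} : IsTest T ↔ T ∈ Icc 0 1 := by
  rw [IsTest, mem_Icc, Matrix.nonneg_iff_posSemidef, Matrix.le_iff]

lemma convex_setOf_isTest [DecidableEq ι] : Convex ℝ {T : Matrix ι ι ℂ | IsTest T} := by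
  intro S hS T hT a b ha hb hab
  refine ⟨(hS.1.smul ha).add (hT.1.smul hb), ?_⟩
  have h : 1 - (a • S + b • T) = a • (1 - S) + b • (1 - T) := by
    have h1 : (1 : Matrix ι ι ℂ) = a • 1 + b • 1 := by rw [← add_smul, hab, one_smul]
    rw [smul_sub, smul_sub]
    nth_rewrite 1 [h1]
    abel
  rw [h]
  exact (hS.2.smul ha).add (hT.2.smul hb)

variable [Fintype ι]

lemma rtr_add (A B : Matrix ι ι ℂ) : rtr (A + B) = rtr A + rtr B := by
  simp [rtr, Matrix.trace_add]

lemma rtr_sub (A B : Matrix ι ι ℂ) : rtr (A - B) = rtr A - rtr B := by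
  simp [rtr, Matrix.trace_sub]

lemma rtr_smul (c : ℝ) (A : Matrix ι ι ℂ) : rtr (c • A) = c * rtr A := by
  simp [rtr, Matrix.trace_smul]

lemma rtr_mul_comm (A B : Matrix ι ι ℂ) : rtr (A * B) = rtr (B * A) := by
  rw [rtr, rtr, Matrix.trace_mul_comm]

lemma continuous_rtr : Continuous (rtr : Matrix ι ι ℂ → ℝ) :=
  Complex.continuous_re.comp continuous_id.matrix_trace

variable [DecidableEq ι]

lemma rtr_mul_nonneg {A B : Matrix ι ι ℂ} (hA : 0 ≤ A) (hB : 0 ≤ B) : 0 ≤ rtr (A * B) := by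
  have h := (Matrix.nonneg_iff_posSemidef.mp
    (star_left_conjugate_nonneg hB (CFC.sqrt A))).trace_nonneg
  rw [(CFC.sqrt_nonneg A).isSelfAdjoint.star_eq, Matrix.trace_mul_cycle,
    CFC.sqrt_mul_sqrt_self A hA] at h
  exact (Complex.le_def.mp h).1

lemma rtr_mul_le_rtr_mul_left {A B C : Matrix ι ι ℂ} (hA : 0 ≤ A) (h : B ≤ C) :
    rtr (A * B) ≤ rtr (A * C) := by
  have := rtr_mul_nonneg hA (sub_nonneg.mpr h)
  rw [mul_sub, rtr_sub] at this
  linarith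

lemma rtr_mul_le_rtr_mul_right {A B C : Matrix ι ι ℂ} (hA : 0 ≤ A) (h : B ≤ C) :
    rtr (B * A) ≤ rtr (C * A) := by
  rw [rtr_mul_comm B, rtr_mul_comm C]
  exact rtr_mul_le_rtr_mul_left hA h

lemma mpow_eq_rpow {A : Matrix ι ι ℂ} (hA : 0 ≤ A) {p : ℝ} (hp : 0 < p) :
    mpow A (p : ℂ) = A ^ p := by
  have hH : A.IsHermitian := (Matrix.nonneg_iff_posSemidef.mp hA).isHermitian
  rw [mpow, dif_pos hH, CFC.rpow_eq_cfc_real hA, hH.cfc_eq, Matrix.IsHermitian.cfc,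
    Unitary.conjStarAlgAut_apply]
  congr 3
  ext i
  have h0 : 0 ≤ hH.eigenvalues i := (Matrix.nonneg_iff_posSemidef.mp hA).eigenvalues_nonneg i
  by_cases h : hH.eigenvalues i = 0
  · simp [h, Real.zero_rpow hp.ne']
  · simp [h, Complex.ofReal_cpow h0]

lemma rpow_mul_rpow_eq_self {A : Matrix ι ι ℂ} (hA : 0 ≤ A) {p q : ℝ} (hp : 0 < p) (hq : 0 < q)
    (hpq : p + q = 1) : A ^ p * A ^ q = A := by
  lift p to NNReal using hp.le
  lift q to NNReal using hq.le
  have hp' : 0 < p := by exact_mod_cast hp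
  have hq' : 0 < q := by exact_mod_cast hq
  have hpq' : p + q = 1 := by exact_mod_cast hpq
  rw [← CFC.nnrpow_eq_rpow hp', ← CFC.nnrpow_eq_rpow hq', ← CFC.nnrpow_add hp' hq', hpq',
    CFC.nnrpow_one A hA]

lemma isCompact_setOf_isTest : IsCompact {T : Matrix ι ι ℂ | IsTest T} := by
  have h : {T : Matrix ι ι ℂ | IsTest T} = Icc 0 1 := by
    ext T
    exact isTest_iff_mem_Icc
  rw [h]
  have : ProperSpace (Matrix ι ι ℂ) := FiniteDimensional.proper ℂ _
  refine Metric.isCompact_of_isClosed_isBounded isClosed_Icc ?_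
  refine (Metric.isBounded_closedBall (x := (0 : Matrix ι ι ℂ)) (r := 1)).subset fun T hT => ?_
  rw [mem_closedBall_zero_iff]
  exact (CStarAlgebra.norm_le_one_iff_of_nonneg T hT.1).mpr hT.2

/-- The spectral projection of a Hermitian matrix onto its positive part. -/
lemma exists_isTest_mul_eq_posPart {H : Matrix ι ι ℂ} (hH : H.IsHermitian) :
    ∃ T P : Matrix ι ι ℂ, IsTest T ∧ 0 ≤ P ∧ H ≤ P ∧ H * T = P := by
  have hsa : IsSelfAdjoint H := hH
  have hc (f : ℝ → ℝ) : ContinuousOn f (spectrum ℝ H) :=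
    (Matrix.finite_real_spectrum (A := H)).continuousOn f
  refine ⟨cfc (fun x : ℝ => if 0 < x then 1 else 0) H, cfc (fun x : ℝ => max x 0) H,
    isTest_iff_mem_Icc.mpr ⟨?_, ?_⟩, ?_, ?_, ?_⟩
  · refine cfc_nonneg fun x _ => ?_
    split_ifs <;> norm_num
  · refine cfc_le_one _ _ fun x _ => ?_
    split_ifs <;> norm_num
  · exact cfc_nonneg fun x _ => le_max_right _ _
  · conv_lhs => rw [← cfc_id' ℝ H]
    exact cfc_mono (fun x _ => le_max_left _ _) (hc _) (hc _)
  · conv_lhs => enter [1]; rw [← cfc_id' ℝ H]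
    rw [← cfc_mul _ _ H (hc _) (hc _)]
    refine cfc_congr fun x _ => ?_
    by_cases hx : 0 < x
    · simp [hx, hx.le]
    · simp [hx, not_lt.mp hx]

/-- The Audenaert et al. inequality for two positive semidefinite matrices. -/
lemma exists_isTest_le_rtr_rpow_mul_rpow {A B : Matrix ι ι ℂ} (hA : 0 ≤ A) (hB : 0 ≤ B)
    {α : ℝ} (hα : α ∈ Ioo (0 : ℝ) 1) :
    ∃ T, IsTest T ∧ rtr (A * (1 - T)) + rtr (B * T) ≤ rtr (A ^ α * B ^ (1 - α)) := by
  obtain ⟨T, P, hT, hP, hle, hmul⟩ :=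
    exists_isTest_mul_eq_posPart ((Matrix.nonneg_iff_posSemidef.mp hA).isHermitian.sub (Matrix.nonneg_iff_posSemidef.mp hB).isHermitian)
  refine ⟨T, hT, ?_⟩
  have hα' : 0 < 1 - α := sub_pos.mpr hα.2
  have hmem : α ∈ Icc (0 : ℝ) 1 := ⟨hα.1.le, hα.2.le⟩
  have hmem' : 1 - α ∈ Icc (0 : ℝ) 1 := ⟨hα'.le, by linarith [hα.1]⟩
  set C := B + P with hC
  have hAC : A ≤ C := sub_le_iff_le_add'.mp hle
  have hBC : B ≤ C := le_add_of_nonneg_right hP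
  have hsplit {X : Matrix ι ι ℂ} (hX : 0 ≤ X) : X ^ α * X ^ (1 - α) = X :=
    rpow_mul_rpow_eq_self hX hα.1 hα' (by ring)
  have h1 : rtr (A ^ α * (A ^ (1 - α) - B ^ (1 - α))) ≤
      rtr (A ^ α * (C ^ (1 - α) - B ^ (1 - α))) :=
    rtr_mul_le_rtr_mul_left CFC.rpow_nonneg
      (sub_le_sub_right (CFC.rpow_le_rpow hmem' hAC) _)
  have h2 : rtr (A ^ α * (C ^ (1 - α) - B ^ (1 - α))) ≤
      rtr (C ^ α * (C ^ (1 - α) - B ^ (1 - α))) :=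
    rtr_mul_le_rtr_mul_right (sub_nonneg.mpr (CFC.rpow_le_rpow hmem' hBC))
      (CFC.rpow_le_rpow hmem hAC)
  have h3 : rtr (B ^ α * B ^ (1 - α)) ≤ rtr (C ^ α * B ^ (1 - α)) :=
    rtr_mul_le_rtr_mul_right CFC.rpow_nonneg (CFC.rpow_le_rpow hmem hBC)
  have h4 : rtr P = rtr (A * T) - rtr (B * T) := by rw [← hmul, sub_mul, rtr_sub]
  have h5 : rtr C = rtr B + rtr P := rtr_add B P
  have h6 : rtr (A * (1 - T)) = rtr A - rtr (A * T) := by rw [mul_sub, mul_one, rtr_sub]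
  simp only [mul_sub, rtr_sub, hsplit hA, hsplit hB, hsplit (hB.trans hBC)] at h1 h2 h3
  linarith

lemma bddAbove_rtr_mpow_mul_mpow {A : Matrix ι ι ℂ} (hA : 0 ≤ A) {S : Set (Matrix ι ι ℂ)}
    (hS : IsCompact S) (hpsd : ∀ B ∈ S, B.PosSemidef) {α : ℝ} (hα : α ∈ Ioo (0 : ℝ) 1) :
    BddAbove ((fun B => rtr (mpow A ((α : ℝ) : ℂ) * mpow B ((1 - α : ℝ) : ℂ))) '' S) := by
  have hα' : 0 < 1 - α := sub_pos.mpr hα.2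
  obtain ⟨c, hc⟩ := hS.isBounded.exists_norm_le
  refine ⟨rtr (A ^ α * (algebraMap ℝ (Matrix ι ι ℂ) c) ^ (1 - α)), ?_⟩
  rintro _ ⟨B, hB, rfl⟩
  have hB0 : 0 ≤ B := (hpsd B hB).nonneg
  have hBc : B ≤ algebraMap ℝ (Matrix ι ι ℂ) c :=
    (CStarAlgebra.norm_le_iff_le_algebraMap B ((norm_nonneg B).trans (hc B hB)) hB0).mp (hc B hB)
  simp only [mpow_eq_rpow hA hα.1, mpow_eq_rpow hB0 hα']
  exact rtr_mul_le_rtr_mul_left CFC.rpow_nonneg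
    (CFC.rpow_le_rpow ⟨hα'.le, by linarith [hα.1]⟩ hBc)

end Audenaert

/-- Lemma 10 of the paper, a generalization of the Audenaert et al.
inequality: existence of a test achieving the composite Chernoff-type bound. -/
theorem audenaert_inequality_composite {d : ℕ}
    (A : Matrix (Fin d) (Fin d) ℂ) (hA : A.PosSemidef)
    (S : Set (Matrix (Fin d) (Fin d) ℂ))
    (hcomp : IsCompact S) (hconv : Convex ℝ S)
    (hpsd : ∀ B ∈ S, B.PosSemidef)
    (α : ℝ) (hα : α ∈ Set.Ioo (0 : ℝ) 1) :
    ∃ T : Matrix (Fin d) (Fin d) ℂ, IsTest T ∧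
      ∀ B ∈ S,
        rtr (A * (1 - T)) + rtr (B * T) ≤
          sSup ((fun B' => rtr (mpow A ((α : ℝ) : ℂ) * mpow B' ((1 - α : ℝ) : ℂ))) '' S) := by
  have hα' : 0 < 1 - α := sub_pos.mpr hα.2
  rcases S.eq_empty_or_nonempty with rfl | hne
  · exact ⟨0, ⟨Matrix.PosSemidef.zero, by simpa using Matrix.PosSemidef.one⟩, by simp⟩
  obtain ⟨T, hT, B₀, hB₀, hsaddle⟩ := Sion.exists_isSaddlePointOn
    (X := {T : Matrix (Fin d) (Fin d) ℂ | IsTest T}) (Y := S)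
    (f := fun T B => rtr (A * (1 - T)) + rtr (B * T))
    ⟨0, Matrix.PosSemidef.zero, by simpa using Matrix.PosSemidef.one⟩
    convex_setOf_isTest isCompact_setOf_isTest
    (fun B _ => ContinuousOn.lowerSemicontinuousOn <| Continuous.continuousOn <|
      ((continuous_rtr.comp (by fun_prop)).add (continuous_rtr.comp (by fun_prop))))
    (fun B _ => ConvexOn.quasiconvexOn ⟨convex_setOf_isTest, fun T _ T' _ a b _ _ hab => by
      simp only [mul_sub, mul_one, rtr_sub, mul_add, rtr_add, mul_smul_comm, rtr_smul, smul_eq_mul]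
      linear_combination (-rtr A) * hab⟩)
    hconv hne hcomp
    (fun T _ => ContinuousOn.upperSemicontinuousOn <| Continuous.continuousOn <|
      (continuous_const.add (continuous_rtr.comp (by fun_prop))))
    (fun T _ => ConcaveOn.quasiconcaveOn ⟨hconv, fun B _ B' _ a b _ _ hab => by
      simp only [add_mul, rtr_add, smul_mul_assoc, rtr_smul, smul_eq_mul]
      linear_combination rtr (A * (1 - T)) * hab⟩)
  refine ⟨T, hT, fun B hB => ?_⟩
  obtain ⟨T', hT', hle⟩ :=
    exists_isTest_le_rtr_rpow_mul_rpow hA.nonneg (hpsd B₀ hB₀).nonneg hα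
  rw [← mpow_eq_rpow hA.nonneg hα.1, ← mpow_eq_rpow (hpsd B₀ hB₀).nonneg hα'] at hle
  exact (hsaddle T' hT' B hB).trans <| hle.trans <|
    le_csSup (bddAbove_rtr_mpow_mul_mpow hA.nonneg hcomp hpsd hα) ⟨B₀, hB₀, rfl⟩

end QHT
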